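/- Let n ≥ 3, m ∈ ℕ and 1 < q < n/(n-2). For every ε > 0 there exists a constant C_ε > 0 such that for every u ∈ H¹(𝔹ⁿ) (equivalently, every smooth u on the closed unit ball) satisfying ∫_{S^{n-1}} p |u|^{q+1} dμ_{S^{n-1}} = 0 for all p ∈ P̊_m, one has (∫_{S^{n-1}} |u|^{q+1} dμ_{S^{n-1}})^{2/(q+1)} ≤ ε ∫_{𝔹ⁿ} |∇u|² dx + C_ε ∫_{S^{n-1}} u² dμ_{S^{n-1}}. -/

import Mathlib

open MeasureTheory Metric Filter
open scoped ENNReal RealInnerProductSpace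

noncomputable section

abbrev E (n : ℕ) : Type := EuclideanSpace ℝ (Fin n)

/-- The standard surface measure on the unit sphere `S^{n-1}`, as a Borel measure on `ℝⁿ`. -/
def sphMeasure (n : ℕ) : Measure (E n) :=
  Measure.map Subtype.val ((volume : Measure (E n)).toSphere)

/-- `P̊_m` : polynomials of degree at most `m` with zero mean on the sphere. -/
def P0 (n m : ℕ) : Set (MvPolynomial (Fin n) ℝ) :=
  {p | p.totalDegree ≤ m ∧ ∫ x, MvPolynomial.eval (fun i => x i) p ∂(sphMeasure n) = 0}

instance sph_fin (n : ℕ) : IsFiniteMeasure (sphMeasure n) := by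
  unfold sphMeasure; infer_instance

lemma sph_ae (n : ℕ) : ∀ᵐ x ∂(sphMeasure n), ‖x‖ = 1 := by
  unfold sphMeasure
  rw [ae_map_iff measurable_subtype_coe.aemeasurable
    (measurableSet_eq_fun measurable_norm measurable_const)]
  refine Eventually.of_forall fun x => ?_
  simp

lemma sph_univ (n : ℕ) (hn : 3 ≤ n) : sphMeasure n Set.univ ≠ 0 := by
  unfold sphMeasure
  rw [Measure.map_apply measurable_subtype_coe MeasurableSet.univ, Set.preimage_univ,
    Measure.toSphere_apply_univ]
  refine mul_ne_zero ?_ (measure_ball_pos _ _ one_pos).ne'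
  simp; omega

lemma cap (n : ℕ) (hn : 3 ≤ n) : ∃ K : ℝ, 0 ≤ K ∧ ∀ (y : E n) (t : ℝ), 0 < t → t < 1 →
    sphMeasure n (closedBall y (2*t)) ≤ ENNReal.ofReal (K * (t^n / t)) := by
  refine ⟨n * (3^n * (volume (ball (0 : E n) 1)).toReal), by positivity, fun y t ht0 ht1 => ?_⟩
  unfold sphMeasure
  have hm : MeasurableSet ((Subtype.val : sphere (0 : E n) 1 → E n) ⁻¹' closedBall y (2*t)) :=
    measurable_subtype_coe isClosed_closedBall.measurableSet
  rw [Measure.map_apply measurable_subtype_coe isClosed_closedBall.measurableSet,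
    Measure.toSphere_apply' _ hm]
  open Pointwise in
  set cone : Set (E n) := Set.Ioo (0:ℝ) 1 • (Subtype.val '' ((Subtype.val : sphere (0 : E n) 1 → E n) ⁻¹' closedBall y (2*t))) with hcone
  have hsub1 : cone ⊆ ball 0 1 := by
    intro z hz
    obtain ⟨s, hs, a, ⟨b, hb, rfl⟩, rfl⟩ := Set.mem_smul.1 hz
    have : ‖(b : E n)‖ = 1 := by simp
    simp [norm_smul, this, abs_of_pos hs.1, hs.2]
  have hfin : volume cone ≠ ⊤ := ((measure_mono hsub1).trans_lt measure_ball_lt_top).ne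
  open Pointwise in
  have hsub2 : cone ⊆ ((1-t) • cone) ∪ closedBall y (3*t) := by
    intro z hz
    obtain ⟨s, hs, a, ⟨b, hb, rfl⟩, rfl⟩ := Set.mem_smul.1 hz
    have hb1 : ‖(b : E n)‖ = 1 := by simp
    by_cases hst : s < 1 - t
    · left
      refine Set.mem_smul_set.2 ⟨(s/(1-t)) • (b : E n), ?_, ?_⟩
      · refine Set.mem_smul.2 ⟨s/(1-t), ⟨div_pos hs.1 (by linarith), ?_⟩, b, ⟨b, hb, rfl⟩, rfl⟩
        rw [div_lt_one (by linarith)]; exact hst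
      · rw [smul_smul, mul_div_cancel₀ _ (by linarith)]
    · right
      rw [mem_closedBall, dist_eq_norm]
      have h1 : ‖(b : E n) - y‖ ≤ 2*t := by
        rw [← dist_eq_norm]; exact hb
      have h2 : s • (b : E n) - y = (s-1) • (b : E n) + ((b : E n) - y) := by
        rw [sub_smul, one_smul]; abel
      rw [h2]
      refine (norm_add_le _ _).trans ?_
      rw [norm_smul, hb1, Real.norm_eq_abs, abs_of_nonpos (by linarith [hs.2])]
      linarith
  have hv := (measure_mono hsub2).trans (measure_union_le (μ := volume) _ _)
  rw [Measure.addHaar_smul, Measure.addHaar_closedBall _ _ (by linarith)] at hv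
  have hB : volume (ball (0 : E n) 1) ≠ ⊤ := measure_ball_lt_top.ne
  have hd : Module.finrank ℝ (E n) = n := by simp
  rw [hd] at hv ⊢
  rw [← ENNReal.ofReal_toReal hfin, ← ENNReal.ofReal_toReal hB, ← ENNReal.ofReal_mul (by positivity),
    ← ENNReal.ofReal_mul (by positivity), ← ENNReal.ofReal_add (by positivity) (by positivity),
    ENNReal.ofReal_le_ofReal_iff (by positivity)] at hv
  rw [← ENNReal.ofReal_toReal hfin, ← ENNReal.ofReal_natCast, ← ENNReal.ofReal_mul (by positivity)]
  apply ENNReal.ofReal_le_ofReal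
  set v := (volume cone).toReal
  have hv0 : 0 ≤ v := ENNReal.toReal_nonneg
  rw [mul_assoc]
  refine mul_le_mul_of_nonneg_left ?_ (by positivity)
  have h3 : (1-t)^n ≤ 1 - t := pow_le_of_le_one (by linarith) (by linarith) (by omega)
  rw [abs_of_nonneg (pow_nonneg (by linarith) _)] at hv
  rw [← mul_div_assoc, le_div_iff₀ ht0]
  rw [mul_pow] at hv
  nlinarith

def Fh {n : ℕ} (h : E n → ℝ≥0∞) (t : ℝ) (x : E n) : ℝ≥0∞ :=
  ∫⁻ w in ball (0 : E n) 1, h ((1-t) • x + t • w)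

lemma Fh_le {n : ℕ} (h : E n → ℝ≥0∞) (hh : Measurable h) (t : ℝ) (ht : 0 < t) (x : E n)
    (hx : ‖x‖ = 1) :
    Fh h t x ≤ ENNReal.ofReal ((t^n)⁻¹) * ∫⁻ y in closedBall x (2*t), h y := by
  unfold Fh
  rw [← lintegral_indicator measurableSet_ball,
    ← lintegral_indicator isClosed_closedBall.measurableSet]
  set k := (closedBall x (2*t)).indicator h with hk
  have hkm : Measurable k := hh.indicator isClosed_closedBall.measurableSet
  have e : ∫⁻ w, k ((1-t) • x + t • w) = ENNReal.ofReal ((t^n)⁻¹) * ∫⁻ y, k y := by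
    have h1 : ∫⁻ w, k ((1-t) • x + t • w) = ∫⁻ z, k ((1-t) • x + z)
        ∂(Measure.map (t • ·) (volume : Measure (E n))) := by
      rw [lintegral_map (by fun_prop) (by fun_prop)]
    rw [h1, Measure.map_addHaar_smul _ ht.ne', lintegral_smul_measure,
      lintegral_add_left_eq_self]
    simp [abs_of_pos ht]
  rw [← e]
  apply lintegral_mono
  intro w
  by_cases hw : w ∈ ball (0 : E n) 1
  · have : (1-t) • x + t • w ∈ closedBall x (2*t) := by
      rw [mem_closedBall, dist_eq_norm]
      have : (1-t) • x + t • w - x = t • (w - x) := by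
        rw [sub_smul, one_smul, smul_sub]; abel
      rw [this, norm_smul, Real.norm_eq_abs, abs_of_pos ht, mul_comm]
      have := norm_sub_le w x
      have hw' : ‖w‖ < 1 := by simpa using hw
      gcongr; linarith
    simp only [hk, Set.indicator_of_mem hw, Set.indicator_of_mem this]; exact le_rfl
  · simp [Set.indicator_of_notMem hw]

lemma Fh_int {n : ℕ} (h : E n → ℝ≥0∞) (hh : Measurable h) (K : ℝ) (hK0 : 0 ≤ K)
    (hK : ∀ (y : E n) (t : ℝ), 0 < t → t < 1 →
      sphMeasure n (closedBall y (2*t)) ≤ ENNReal.ofReal (K * (t^n / t)))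
    (t : ℝ) (ht : 0 < t) (ht1 : t < 1) :
    ∫⁻ x, Fh h t x ∂(sphMeasure n) ≤ ENNReal.ofReal (K * t⁻¹) * ∫⁻ y, h y := by
  calc ∫⁻ x, Fh h t x ∂(sphMeasure n)
      ≤ ∫⁻ x, ENNReal.ofReal ((t^n)⁻¹) * (∫⁻ y in closedBall x (2*t), h y) ∂(sphMeasure n) := by
        apply lintegral_mono_ae
        filter_upwards [sph_ae n] with x hx using Fh_le h hh t ht x hx
    _ = ENNReal.ofReal ((t^n)⁻¹) *
        ∫⁻ x, ∫⁻ y, {p : E n × E n | dist p.2 p.1 ≤ 2*t}.indicator (fun p => h p.2) (x, y) ∂(volume : Measure (E n)) ∂(sphMeasure n) := by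
        rw [lintegral_const_mul' _ _ ENNReal.ofReal_ne_top]
        congr 1
        apply lintegral_congr
        intro x
        rw [← lintegral_indicator isClosed_closedBall.measurableSet]
        rfl
    _ = ENNReal.ofReal ((t^n)⁻¹) *
        ∫⁻ y, ∫⁻ x, {p : E n × E n | dist p.2 p.1 ≤ 2*t}.indicator (fun p => h p.2) (x, y) ∂(sphMeasure n) := by
        rw [lintegral_lintegral_swap]
        apply Measurable.aemeasurable
        apply Measurable.indicator (by fun_prop)
        exact measurableSet_le (by fun_prop) (by fun_prop)
    _ ≤ ENNReal.ofReal ((t^n)⁻¹) * ∫⁻ y, ENNReal.ofReal (K * (t^n / t)) * h y := by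
        gcongr with y
        have : (fun x => {p : E n × E n | dist p.2 p.1 ≤ 2*t}.indicator (fun p => h p.2) (x, y))
          = (closedBall y (2*t)).indicator (fun _ => h y) := by
          ext x
          simp [Set.indicator, dist_comm]
        rw [this, lintegral_indicator isClosed_closedBall.measurableSet, setLIntegral_const, mul_comm]
        gcongr
        exact hK y t ht ht1
    _ = _ := by
        rw [lintegral_const_mul' _ _ ENNReal.ofReal_ne_top, ← mul_assoc,
          ← ENNReal.ofReal_mul (by positivity)]
        congr 2
        field_simp


lemma Fh_meas {n : ℕ} (h : E n → ℝ≥0∞) (hh : Measurable h) :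
    Measurable (fun p : ℝ × E n => Fh h p.1 p.2) := by
  unfold Fh
  apply Measurable.lintegral_prod_right' (f := fun q : (ℝ × E n) × E n =>
    h ((1-q.1.1) • q.1.2 + q.1.1 • q.2))
  fun_prop

def Dg {n : ℕ} (g : E n → ℝ≥0∞) (x : E n) : ℝ≥0∞ :=
  ∫⁻ t in Set.Ioo (0:ℝ) 1, Fh g t x

lemma Dg_meas {n : ℕ} (h : E n → ℝ≥0∞) (hh : Measurable h) : Measurable (Dg h) := by
  unfold Dg
  apply Measurable.lintegral_prod_left' (f := fun p : ℝ × E n => Fh h p.1 p.2) (Fh_meas h hh)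

lemma Fh_cs {n : ℕ} (g : E n → ℝ≥0∞) (hg : Measurable g) (t : ℝ) (x : E n) (r : ℝ) (hr : 2 < r) :
    (Fh g t x) ^ r ≤ (volume (ball (0 : E n) 1)) ^ (r/2) * (Fh (fun y => g y ^ (2:ℝ)) t x) ^ (r/2) := by
  have h1 : Fh g t x ≤ (volume (ball (0 : E n) 1)) ^ (1/2:ℝ) * (Fh (fun y => g y ^ (2:ℝ)) t x) ^ (1/2:ℝ) := by
    unfold Fh
    have := ENNReal.lintegral_mul_le_Lp_mul_Lq (volume.restrict (ball (0 : E n) 1))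
      Real.HolderConjugate.two_two (f := fun _ => 1) (g := fun w => g ((1-t) • x + t • w))
      aemeasurable_const (by fun_prop)
    simpa using this
  calc (Fh g t x) ^ r ≤ _ := ENNReal.rpow_le_rpow h1 (by linarith)
    _ = _ := by
      rw [ENNReal.mul_rpow_of_nonneg _ _ (by linarith), ← ENNReal.rpow_mul, ← ENNReal.rpow_mul]
      congr 2 <;> ring

lemma lint_rpow_fin (b : ℝ) (hb : -1 < b) :
    ∫⁻ t in Set.Ioo (0:ℝ) 1, ENNReal.ofReal (t ^ b) ≠ ⊤ := by
  have h := (intervalIntegral.intervalIntegrable_rpow' (a := 0) (b := 1) hb)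
  rw [intervalIntegrable_iff_integrableOn_Ioo_of_le zero_le_one] at h
  exact h.lintegral_lt_top.ne

lemma Dg_pow {n : ℕ} (g : E n → ℝ≥0∞) (hg : Measurable g) (x : E n) (r a : ℝ) (hr : 2 < r) :
    (Dg g x) ^ r ≤ (∫⁻ t in Set.Ioo (0:ℝ) 1, ENNReal.ofReal (t ^ (-(a/(r-1))))) ^ (r-1) *
      ∫⁻ t in Set.Ioo (0:ℝ) 1, ENNReal.ofReal (t ^ a) * (Fh g t x) ^ r := by
  have hF : Measurable (fun t => Fh g t x) := (Fh_meas g hg).comp (by fun_prop : Measurable fun t : ℝ => (t, x))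
  have hc : (r/(r-1)).HolderConjugate r := by
    have : r.HolderConjugate (r/(r-1)) := Real.HolderConjugate.conjExponent (by linarith)
    exact this.symm
  have h1 : Dg g x ≤ (∫⁻ t in Set.Ioo (0:ℝ) 1, ENNReal.ofReal (t ^ (-(a/(r-1))))) ^ (1/(r/(r-1))) *
      (∫⁻ t in Set.Ioo (0:ℝ) 1, ENNReal.ofReal (t ^ a) * (Fh g t x) ^ r) ^ (1/r) := by
    have := ENNReal.lintegral_mul_le_Lp_mul_Lq (volume.restrict (Set.Ioo (0:ℝ) 1)) hc
      (f := fun t => ENNReal.ofReal (t ^ (-(a/r)))) (g := fun t => ENNReal.ofReal (t ^ (a/r)) * Fh g t x)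
      (by fun_prop) (by fun_prop)
    refine le_trans (le_of_eq ?_) (this.trans (le_of_eq ?_))
    · unfold Dg
      apply setLIntegral_congr_fun measurableSet_Ioo
      intro t ht
      simp only [Pi.mul_apply]
      rw [← mul_assoc, ← ENNReal.ofReal_mul (Real.rpow_nonneg ht.1.le _), ← Real.rpow_add ht.1]
      simp
    · congr 2
      · apply setLIntegral_congr_fun measurableSet_Ioo
        intro t ht
        simp only
        rw [ENNReal.ofReal_rpow_of_nonneg (Real.rpow_nonneg ht.1.le _) (by apply div_nonneg <;> linarith),
          ← Real.rpow_mul ht.1.le]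
        congr 2
        have : r - 1 ≠ 0 := by linarith
        field_simp
      · apply setLIntegral_congr_fun measurableSet_Ioo
        intro t ht
        simp only
        rw [ENNReal.mul_rpow_of_nonneg _ _ (by linarith),
          ENNReal.ofReal_rpow_of_nonneg (Real.rpow_nonneg ht.1.le _) (by linarith),
          ← Real.rpow_mul ht.1.le]
        congr 3
        field_simp
  calc (Dg g x) ^ r ≤ _ := ENNReal.rpow_le_rpow h1 (by linarith)
    _ = _ := by
      have : r - 1 ≠ 0 := by linarith
      rw [ENNReal.mul_rpow_of_nonneg _ _ (by linarith), ← ENNReal.rpow_mul, ← ENNReal.rpow_mul]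
      congr 2
      · field_simp
      · rw [one_div_mul_cancel (by linarith), ENNReal.rpow_one]

set_option maxHeartbeats 1000000 in
lemma Dg_Lr (n : ℕ) (hn : 3 ≤ n) (r : ℝ) (hr : 2 < r) (hr2 : r * (n - 2) < 2 * (n - 1)) :
    ∃ C : ℝ≥0∞, C ≠ ⊤ ∧ ∀ g : E n → ℝ≥0∞, Measurable g →
      ∫⁻ x, (Dg g x) ^ r ∂(sphMeasure n) ≤ C * (∫⁻ y, g y ^ (2:ℝ)) ^ (r/2) := by
  obtain ⟨K, hK0, hK⟩ := cap n hn
  obtain ⟨a, ha1, ha2⟩ := exists_between (show (n:ℝ) * (r/2-1) < r - 1 by linarith)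
  set A := (∫⁻ t in Set.Ioo (0:ℝ) 1, ENNReal.ofReal (t ^ (-(a/(r-1))))) ^ (r-1) with hA
  have hAfin : A ≠ ⊤ := by
    apply ENNReal.rpow_ne_top_of_nonneg (by linarith)
    apply lint_rpow_fin
    rw [neg_lt_neg_iff, div_lt_one (by linarith)]; exact ha2
  set V := volume (ball (0 : E n) 1) with hV
  have hVfin : V ≠ ⊤ := measure_ball_lt_top.ne
  set b := a - n * (r/2-1) - 1 with hb
  set J := ∫⁻ t in Set.Ioo (0:ℝ) 1, ENNReal.ofReal (t ^ b) with hJ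
  have hJfin : J ≠ ⊤ := lint_rpow_fin b (by rw [hb]; linarith)
  refine ⟨A * (V ^ (r/2) * (ENNReal.ofReal K * J)), ?_, fun g hg => ?_⟩
  · refine ENNReal.mul_ne_top hAfin (ENNReal.mul_ne_top ?_ (ENNReal.mul_ne_top ENNReal.ofReal_ne_top hJfin))
    exact ENNReal.rpow_ne_top_of_nonneg (by linarith) hVfin
  set h : E n → ℝ≥0∞ := fun y => g y ^ (2:ℝ) with hh
  have hhm : Measurable h := by fun_prop
  set H := ∫⁻ y, h y with hH
  have hFm := Fh_meas h hhm
  have hFgm := Fh_meas g hg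
  calc ∫⁻ x, (Dg g x) ^ r ∂(sphMeasure n)
      ≤ ∫⁻ x, A * ∫⁻ t in Set.Ioo (0:ℝ) 1, ENNReal.ofReal (t ^ a) *
          (V ^ (r/2) * (Fh h t x * (ENNReal.ofReal ((t^n)⁻¹) * H) ^ (r/2-1))) ∂(volume : Measure ℝ) ∂(sphMeasure n) := by
        apply lintegral_mono_ae
        filter_upwards [sph_ae n] with x hx
        refine (Dg_pow g hg x r a hr).trans ?_
        refine mul_le_mul_right ?_ _
        apply setLIntegral_mono' measurableSet_Ioo
        intro t ht
        refine mul_le_mul_right ?_ _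
        refine (Fh_cs g hg t x r hr).trans ?_
        refine mul_le_mul_right ?_ _
        have e : r/2 = 1 + (r/2-1) := by ring
        conv_lhs => rw [e, ENNReal.rpow_add_of_nonneg _ _ zero_le_one (by linarith), ENNReal.rpow_one]
        refine mul_le_mul_right ?_ _
        apply ENNReal.rpow_le_rpow _ (by linarith)
        refine (Fh_le h hhm t ht.1 x hx).trans ?_
        refine mul_le_mul_right ?_ _
        exact setLIntegral_le_lintegral _ _
    _ = A * ∫⁻ t in Set.Ioo (0:ℝ) 1, ∫⁻ x, ENNReal.ofReal (t ^ a) *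
          (V ^ (r/2) * (Fh h t x * (ENNReal.ofReal ((t^n)⁻¹) * H) ^ (r/2-1))) ∂(sphMeasure n) := by
        rw [lintegral_const_mul' _ _ hAfin, lintegral_lintegral_swap]
        apply Measurable.aemeasurable
        have : Measurable (fun p : E n × ℝ => Fh h p.2 p.1) := hFm.comp measurable_swap
        simp only [Function.uncurry_def]
        fun_prop
    _ ≤ A * ∫⁻ t in Set.Ioo (0:ℝ) 1, (V ^ (r/2) * (ENNReal.ofReal K * H^(r/2))) * ENNReal.ofReal (t ^ b) := by
        refine mul_le_mul_right ?_ _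
        apply setLIntegral_mono' measurableSet_Ioo
        intro t ht
        have ht0 := ht.1
        have hm : Measurable (fun x => Fh h t x) := hFm.comp (by fun_prop : Measurable fun x : E n => (t, x))
        rw [lintegral_const_mul _ ((hm.mul_const _).const_mul _), lintegral_const_mul _ (hm.mul_const _),
          lintegral_mul_const _ hm]
        calc _ ≤ ENNReal.ofReal (t ^ a) * (V ^ (r/2) * ((ENNReal.ofReal (K * t⁻¹) * H) *
                (ENNReal.ofReal ((t^n)⁻¹) * H) ^ (r/2-1))) := by
              gcongr
              exact Fh_int h hhm K hK0 hK t ht.1 ht.2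
          _ = _ := by
            have e : r/2 = 1 + (r/2-1) := by ring
            have e2 : H ^ (r/2) = H * H ^ (r/2-1) := by
              conv_lhs => rw [e, ENNReal.rpow_add_of_nonneg _ _ zero_le_one (by linarith), ENNReal.rpow_one]
            have e3 : ENNReal.ofReal (t^b) = ENNReal.ofReal (t^a) * ENNReal.ofReal (t⁻¹) *
                (ENNReal.ofReal ((t^n)⁻¹)) ^ (r/2-1) := by
              rw [ENNReal.ofReal_rpow_of_nonneg (by positivity) (by linarith),
                ← ENNReal.ofReal_mul (by positivity), ← ENNReal.ofReal_mul (by positivity)]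
              congr 1
              rw [← Real.rpow_natCast, ← Real.rpow_neg ht0.le, ← Real.rpow_mul ht0.le,
                ← Real.rpow_neg_one t, ← Real.rpow_add ht0, ← Real.rpow_add ht0, hb]
              congr 1; ring
            rw [e2, e3, ENNReal.mul_rpow_of_nonneg _ _ (by linarith), ENNReal.ofReal_mul hK0]
            ring
    _ = _ := by
        rw [lintegral_const_mul _ (by fun_prop)]
        ring


lemma ftc_bound {n : ℕ} (u : E n → ℝ) (hu : ContDiff ℝ (⊤ : ℕ∞) u) (x w : E n) :
    ‖u x - u w‖ₑ ≤ ∫⁻ t in Set.Ioo (0:ℝ) 1, ‖fderiv ℝ u ((1-t) • x + t • w)‖ₑ * ‖w - x‖ₑ := by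
  have hc : Continuous (fderiv ℝ u) := hu.continuous_fderiv (by simp)
  have hd : ∀ t ∈ Set.uIcc (0:ℝ) 1, HasDerivAt (fun t : ℝ => u ((1-t) • x + t • w))
      (fderiv ℝ u ((1-t) • x + t • w) (w - x)) t := by
    intro t _
    have h1 : HasDerivAt (fun t : ℝ => (1-t) • x + t • w) (w - x) t := by
      have := (((hasDerivAt_id t).const_sub 1).smul_const x).add ((hasDerivAt_id t).smul_const w)
      have e : (-1 : ℝ) • x + (1 : ℝ) • w = w - x := by
        rw [neg_one_smul, one_smul]; abel
      rw [e] at this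
      exact this
    have h2 := (hu.differentiable (by simp) ((1-t) • x + t • w)).hasFDerivAt
    exact h2.comp_hasDerivAt t h1
  have h3 := intervalIntegral.integral_eq_sub_of_hasDerivAt hd
    (Continuous.intervalIntegrable (by fun_prop) _ _)
  simp only [sub_self, zero_smul, one_smul, zero_add, sub_zero, add_zero] at h3
  rw [← enorm_neg, neg_sub, ← h3, intervalIntegral.integral_of_le zero_le_one,
    integral_Ioc_eq_integral_Ioo]
  refine (enorm_integral_le_lintegral_enorm _).trans ?_
  apply lintegral_mono
  intro t
  exact ContinuousLinearMap.le_opENorm _ _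

def gu {n : ℕ} (u : E n → ℝ) : E n → ℝ≥0∞ :=
  (ball (0 : E n) 1).indicator (fun x => ‖fderiv ℝ u x‖ₑ)

lemma gu_meas {n : ℕ} (u : E n → ℝ) (hu : ContDiff ℝ (⊤ : ℕ∞) u) : Measurable (gu u) := by
  have hc : Continuous (fderiv ℝ u) := hu.continuous_fderiv (by simp)
  exact (hc.enorm.measurable).indicator measurableSet_ball

lemma diff_bound {n : ℕ} (u : E n → ℝ) (hu : ContDiff ℝ (⊤ : ℕ∞) u) (x : E n) (hx : ‖x‖ = 1) :
    ∫⁻ w in ball (0 : E n) 1, ‖u x - u w‖ₑ ≤ 2 * Dg (gu u) x := by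
  have hgm := gu_meas u hu
  calc ∫⁻ w in ball (0 : E n) 1, ‖u x - u w‖ₑ
      ≤ ∫⁻ w in ball (0 : E n) 1, ∫⁻ t in Set.Ioo (0:ℝ) 1, 2 * gu u ((1-t) • x + t • w) := by
        apply setLIntegral_mono' measurableSet_ball
        intro w hw
        refine (ftc_bound u hu x w).trans ?_
        apply setLIntegral_mono' measurableSet_Ioo
        intro t ht
        have hw' : ‖w‖ < 1 := by simpa using hw
        have hm : (1-t) • x + t • w ∈ ball (0 : E n) 1 := by
          rw [mem_ball_zero_iff]
          refine (norm_add_le _ _).trans_lt ?_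
          rw [norm_smul, norm_smul, hx, Real.norm_eq_abs, Real.norm_eq_abs, abs_of_pos ht.1,
            abs_of_pos (by linarith [ht.2])]
          nlinarith [ht.1]
        rw [gu, Set.indicator_of_mem hm, mul_comm]
        gcongr
        rw [← ofReal_norm]
        have := norm_sub_le w x
        refine (ENNReal.ofReal_le_ofReal (show ‖w - x‖ ≤ 2 by linarith)).trans ?_
        simp
    _ = ∫⁻ t in Set.Ioo (0:ℝ) 1, ∫⁻ w in ball (0 : E n) 1, 2 * gu u ((1-t) • x + t • w) := by
        rw [lintegral_lintegral_swap]
        apply Measurable.aemeasurable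
        simp only [Function.uncurry_def]
        fun_prop
    _ = 2 * Dg (gu u) x := by
        unfold Dg Fh
        rw [← lintegral_const_mul' _ _ (by simp)]
        apply lintegral_congr
        intro t
        rw [lintegral_const_mul' _ _ (by simp)]

lemma two_pt {n : ℕ} (u : E n → ℝ) (hu : ContDiff ℝ (⊤ : ℕ∞) u) (x z : E n) (hx : ‖x‖ = 1)
    (hz : ‖z‖ = 1) :
    volume (ball (0 : E n) 1) * ‖u x‖ₑ ≤ volume (ball (0 : E n) 1) * ‖u z‖ₑ +
      2 * Dg (gu u) x + 2 * Dg (gu u) z := by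
  have hc := hu.continuous
  calc volume (ball (0 : E n) 1) * ‖u x‖ₑ = ∫⁻ w in ball (0 : E n) 1, ‖u x‖ₑ := by
        rw [setLIntegral_const, mul_comm]
    _ ≤ ∫⁻ w in ball (0 : E n) 1, (‖u z‖ₑ + ‖u x - u w‖ₑ + ‖u z - u w‖ₑ) := by
        apply lintegral_mono
        intro w
        have : u x = u z + (u x - u w) + -(u z - u w) := by ring
        calc ‖u x‖ₑ = ‖u z + (u x - u w) + -(u z - u w)‖ₑ := by rw [← this]
          _ ≤ _ := by
            refine (enorm_add_le _ _).trans ?_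
            rw [enorm_neg]
            exact add_le_add (enorm_add_le _ _) le_rfl
    _ = volume (ball (0 : E n) 1) * ‖u z‖ₑ + (∫⁻ w in ball (0 : E n) 1, ‖u x - u w‖ₑ) +
        ∫⁻ w in ball (0 : E n) 1, ‖u z - u w‖ₑ := by
        rw [lintegral_add_right _ (by fun_prop), lintegral_add_right _ (by fun_prop),
          setLIntegral_const, mul_comm]
    _ ≤ _ := by
        gcongr
        · exact diff_bound u hu x hx
        · exact diff_bound u hu z hz

lemma lint_holder {n : ℕ} (f : E n → ℝ≥0∞) (hf : Measurable f) (r : ℝ) (hr : 1 < r) :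
    ∫⁻ x, f x ∂(sphMeasure n) ≤
      (sphMeasure n Set.univ) ^ (1/(r/(r-1))) * (∫⁻ x, f x ^ r ∂(sphMeasure n)) ^ (1/r) := by
  have hc : (r/(r-1)).HolderConjugate r := by
    have : r.HolderConjugate (r/(r-1)) := Real.HolderConjugate.conjExponent (by linarith)
    exact this.symm
  have := ENNReal.lintegral_mul_le_Lp_mul_Lq (sphMeasure n) hc
      (f := fun _ => 1) (g := f) aemeasurable_const hf.aemeasurable
  simpa using this

set_option maxHeartbeats 1000000 in
lemma trace_enn (n : ℕ) (hn : 3 ≤ n) (r : ℝ) (hr : 2 < r) (hr2 : r * (n - 2) < 2 * (n - 1)) :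
    ∃ C : ℝ≥0∞, C ≠ ⊤ ∧ ∀ u : E n → ℝ, ContDiff ℝ (⊤ : ℕ∞) u →
      ∫⁻ x, ‖u x‖ₑ ^ r ∂(sphMeasure n) ≤
        C * ((∫⁻ y, gu u y ^ (2:ℝ)) + ∫⁻ x, ‖u x‖ₑ ^ (2:ℝ) ∂(sphMeasure n)) ^ (r/2) := by
  obtain ⟨C, hC, hD⟩ := Dg_Lr n hn r hr hr2
  set V := volume (ball (0 : E n) 1) with hV
  have hVfin : V ≠ ⊤ := measure_ball_lt_top.ne
  have hV0 : V ≠ 0 := (measure_ball_pos _ _ one_pos).ne'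
  set m := sphMeasure n Set.univ with hm
  have hm0 : m ≠ 0 := sph_univ n hn
  have hmfin : m ≠ ⊤ := measure_ne_top _ _
  set c1 := (V * m)⁻¹ * (V * m ^ (1/2:ℝ) + 2 * (m ^ (1/(r/(r-1))) * C ^ (1/r))) with hc1
  set c3 := (V * m)⁻¹ * (2 * m) with hc3
  have hVm : (V * m)⁻¹ ≠ ⊤ := ENNReal.inv_ne_top.2 (mul_ne_zero hV0 hm0)
  have hr1 : 0 ≤ 1 / (r/(r-1)) := by
    have : 0 < r - 1 := by linarith
    positivity
  have hc1fin : c1 ≠ ⊤ := by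
    refine ENNReal.mul_ne_top hVm (ENNReal.add_ne_top.2 ⟨ENNReal.mul_ne_top hVfin ?_,
      ENNReal.mul_ne_top (by simp) (ENNReal.mul_ne_top ?_ ?_)⟩)
    · exact ENNReal.rpow_ne_top_of_nonneg (by norm_num) hmfin
    · exact ENNReal.rpow_ne_top_of_nonneg hr1 hmfin
    · exact ENNReal.rpow_ne_top_of_nonneg (by positivity) hC
  have hc3fin : c3 ≠ ⊤ := ENNReal.mul_ne_top hVm (ENNReal.mul_ne_top (by simp) hmfin)
  refine ⟨2 ^ (r-1) * (c1 ^ r * m + c3 ^ r * C), ?_, fun u hu => ?_⟩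
  · refine ENNReal.mul_ne_top (ENNReal.rpow_ne_top_of_nonneg (by linarith) (by simp))
      (ENNReal.add_ne_top.2 ⟨ENNReal.mul_ne_top (ENNReal.rpow_ne_top_of_nonneg (by linarith) hc1fin) hmfin,
        ENNReal.mul_ne_top (ENNReal.rpow_ne_top_of_nonneg (by linarith) hc3fin) hC⟩)
  have hgm := gu_meas u hu
  have hDm := Dg_meas (gu u) hgm
  have huc := hu.continuous
  have hDu := hD (gu u) hgm
  set H := ∫⁻ y, gu u y ^ (2:ℝ) with hH
  set S := ∫⁻ x, ‖u x‖ₑ ^ (2:ℝ) ∂(sphMeasure n) with hS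
  set T := H + S with hT
  have hu1 : ∫⁻ x, ‖u x‖ₑ ∂(sphMeasure n) ≤ m ^ (1/2:ℝ) * T ^ (1/2:ℝ) := by
    have h := lint_holder (n := n) (fun x => ‖u x‖ₑ) (by fun_prop) 2 (by norm_num)
    rw [show (1 / (2/(2-1)) : ℝ) = 1/2 by norm_num] at h
    refine h.trans ?_
    refine mul_le_mul_right (ENNReal.rpow_le_rpow ?_ (by norm_num)) _
    exact le_add_self
  have hD1 : ∫⁻ x, Dg (gu u) x ∂(sphMeasure n) ≤ m ^ (1/(r/(r-1))) * C ^ (1/r) * T ^ (1/2:ℝ) := by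
    refine (lint_holder (Dg (gu u)) hDm r (by linarith)).trans ?_
    rw [mul_assoc]
    gcongr
    calc _ ≤ (C * H ^ (r/2)) ^ (1/r) := ENNReal.rpow_le_rpow hDu (by positivity)
      _ = C ^ (1/r) * H ^ (1/2:ℝ) := by
        rw [ENNReal.mul_rpow_of_nonneg _ _ (by positivity), ← ENNReal.rpow_mul]
        congr 2; field_simp
      _ ≤ _ := by gcongr; exact le_self_add
  have hpt : ∀ᵐ x ∂(sphMeasure n), ‖u x‖ₑ ≤ c1 * T ^ (1/2:ℝ) + c3 * Dg (gu u) x := by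
    filter_upwards [sph_ae n] with x hx
    have h1 : ∫⁻ z, V * ‖u x‖ₑ ∂(sphMeasure n) ≤
        ∫⁻ z, (V * ‖u z‖ₑ + 2 * Dg (gu u) x + 2 * Dg (gu u) z) ∂(sphMeasure n) := by
      apply lintegral_mono_ae
      filter_upwards [sph_ae n] with z hz using two_pt u hu x z hx hz
    rw [lintegral_const, lintegral_add_right _ (by fun_prop), lintegral_add_right _ (by fun_prop),
      lintegral_const, lintegral_const_mul _ (by fun_prop), lintegral_const_mul _ (by fun_prop), ← hm] at h1
    have h2 : V * m * ‖u x‖ₑ ≤ V * (m ^ (1/2:ℝ) * T ^ (1/2:ℝ)) + 2 * Dg (gu u) x * m +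
        2 * (m ^ (1/(r/(r-1))) * C ^ (1/r) * T ^ (1/2:ℝ)) := by
      calc V * m * ‖u x‖ₑ = V * ‖u x‖ₑ * m := by ring
        _ ≤ _ := h1
        _ ≤ _ := by gcongr
    calc ‖u x‖ₑ = (V * m)⁻¹ * (V * m * ‖u x‖ₑ) := by
          rw [← mul_assoc, ENNReal.inv_mul_cancel (mul_ne_zero hV0 hm0) (ENNReal.mul_ne_top hVfin hmfin), one_mul]
      _ ≤ _ := mul_le_mul_right h2 _
      _ = _ := by rw [hc1, hc3]; ring
  calc ∫⁻ x, ‖u x‖ₑ ^ r ∂(sphMeasure n)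
      ≤ ∫⁻ x, 2 ^ (r-1) * ((c1 * T ^ (1/2:ℝ)) ^ r + c3 ^ r * (Dg (gu u) x) ^ r) ∂(sphMeasure n) := by
        apply lintegral_mono_ae
        filter_upwards [hpt] with x hx
        refine (ENNReal.rpow_le_rpow hx (by linarith)).trans ?_
        refine (ENNReal.rpow_add_le_mul_rpow_add_rpow _ _ (by linarith)).trans ?_
        rw [ENNReal.mul_rpow_of_nonneg c3 _ (by linarith)]
    _ = 2 ^ (r-1) * ((c1 * T ^ (1/2:ℝ)) ^ r * m + c3 ^ r * ∫⁻ x, (Dg (gu u) x) ^ r ∂(sphMeasure n)) := by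
        rw [lintegral_const_mul _ (by fun_prop), lintegral_add_left (by fun_prop), lintegral_const,
          lintegral_const_mul _ (by fun_prop)]
    _ ≤ 2 ^ (r-1) * ((c1 * T ^ (1/2:ℝ)) ^ r * m + c3 ^ r * (C * T ^ (r/2))) := by
        gcongr
        refine hDu.trans ?_
        gcongr
        exact le_self_add
    _ = _ := by
        rw [ENNReal.mul_rpow_of_nonneg c1 _ (by linarith), ← ENNReal.rpow_mul,
          show (1/2 * r : ℝ) = r/2 by ring]
        ring


lemma int_sph {n : ℕ} (f : E n → ℝ) (hf : Continuous f) : Integrable f (sphMeasure n) := by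
  obtain ⟨C, hC⟩ := (isCompact_sphere (0 : E n) 1).exists_bound_of_continuousOn hf.continuousOn
  refine Integrable.of_bound hf.aestronglyMeasurable C ?_
  filter_upwards [sph_ae n] with x hx
  exact hC x (by simpa using hx)

lemma conv_sph {n : ℕ} (u : E n → ℝ) (hu : Continuous u) (r : ℝ) (hr : 0 ≤ r) :
    ∫⁻ x, ‖u x‖ₑ ^ r ∂(sphMeasure n) = ENNReal.ofReal (∫ x, |u x| ^ r ∂(sphMeasure n)) := by
  rw [ofReal_integral_eq_lintegral_ofReal
    (int_sph _ (hu.abs.rpow_const (fun _ => Or.inr hr)))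
    (Eventually.of_forall fun x => by positivity)]
  apply lintegral_congr
  intro x
  rw [← ofReal_norm, ENNReal.ofReal_rpow_of_nonneg (norm_nonneg _) hr, Real.norm_eq_abs]

lemma conv_ball {n : ℕ} (u : E n → ℝ) (hu : ContDiff ℝ (⊤ : ℕ∞) u) :
    ∫⁻ y, gu u y ^ (2:ℝ) =
      ENNReal.ofReal (∫ x in Metric.ball (0 : E n) 1, ‖fderiv ℝ u x‖ ^ 2) := by
  have hc : Continuous (fderiv ℝ u) := hu.continuous_fderiv (by simp)
  have hi : IntegrableOn (fun x => ‖fderiv ℝ u x‖ ^ 2) (ball (0 : E n) 1) := by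
    have : IntegrableOn (fun x => ‖fderiv ℝ u x‖ ^ 2) (closedBall (0 : E n) 1) :=
      ContinuousOn.integrableOn_compact (isCompact_closedBall _ _) (by fun_prop)
    exact this.mono_set ball_subset_closedBall
  rw [ofReal_integral_eq_lintegral_ofReal hi (Eventually.of_forall fun x => by positivity),
    ← lintegral_indicator measurableSet_ball]
  apply lintegral_congr
  intro x
  unfold gu
  by_cases hx : x ∈ ball (0 : E n) 1
  · rw [Set.indicator_of_mem hx, Set.indicator_of_mem hx, ← ofReal_norm,
      ENNReal.ofReal_rpow_of_nonneg (norm_nonneg _) (by norm_num)]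
    norm_num
  · rw [Set.indicator_of_notMem hx, Set.indicator_of_notMem hx]
    simp

lemma trace_real (n : ℕ) (hn : 3 ≤ n) (r : ℝ) (hr : 2 < r) (hr2 : r * (n - 2) < 2 * (n - 1)) :
    ∃ C : ℝ, 0 ≤ C ∧ ∀ u : E n → ℝ, ContDiff ℝ (⊤ : ℕ∞) u →
      ∫ x, |u x| ^ r ∂(sphMeasure n) ≤
        C * ((∫ x in Metric.ball (0 : E n) 1, ‖fderiv ℝ u x‖ ^ 2) +
          ∫ x, (u x) ^ 2 ∂(sphMeasure n)) ^ (r/2) := by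
  obtain ⟨C, hC, h⟩ := trace_enn n hn r hr hr2
  refine ⟨C.toReal, ENNReal.toReal_nonneg, fun u hu => ?_⟩
  have h1 := h u hu
  have hG : 0 ≤ ∫ x in Metric.ball (0 : E n) 1, ‖fderiv ℝ u x‖ ^ 2 :=
    integral_nonneg fun x => by positivity
  have hS : 0 ≤ ∫ x, (u x) ^ 2 ∂(sphMeasure n) := integral_nonneg fun x => by positivity
  have e : ∫ x, |u x| ^ (2:ℝ) ∂(sphMeasure n) = ∫ x, (u x) ^ 2 ∂(sphMeasure n) := by
    congr 1; ext x; simp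
  rw [conv_sph u hu.continuous r (by linarith), conv_sph u hu.continuous 2 (by norm_num),
    conv_ball u hu, e, ← ENNReal.ofReal_add hG hS,
    ENNReal.ofReal_rpow_of_nonneg (by positivity) (by linarith),
    ← ENNReal.ofReal_toReal hC, ← ENNReal.ofReal_mul ENNReal.toReal_nonneg] at h1
  rwa [ENNReal.ofReal_le_ofReal_iff (by positivity)] at h1

lemma interp_pt (p r l a : ℝ) (hp : 2 < p) (hpr : p < r) (hl : 0 < l) (ha : 0 ≤ a) :
    a ^ p ≤ l ^ (p-r) * a ^ r + l ^ (p-2) * a ^ (2:ℝ) := by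
  rcases eq_or_lt_of_le ha with rfl | ha
  · rw [Real.zero_rpow (by linarith)]; positivity
  rcases le_total l a with h | h
  · have h1 : a ^ p = a ^ (p-r) * a ^ r := by rw [← Real.rpow_add ha]; congr 1; ring
    have h2 : a ^ (p-r) ≤ l ^ (p-r) := Real.rpow_le_rpow_of_nonpos hl h (by linarith)
    have h3 : 0 ≤ l ^ (p-2) * a ^ (2:ℝ) := by positivity
    have h4 : a ^ (p-r) * a ^ r ≤ l ^ (p-r) * a ^ r := by gcongr
    linarith
  · have h1 : a ^ p = a ^ (p-2) * a ^ (2:ℝ) := by rw [← Real.rpow_add ha]; congr 1; ring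
    have h2 : a ^ (p-2) ≤ l ^ (p-2) := Real.rpow_le_rpow ha.le h (by linarith)
    have h3 : 0 ≤ l ^ (p-r) * a ^ r := by positivity
    have h4 : a ^ (p-2) * a ^ (2:ℝ) ≤ l ^ (p-2) * a ^ (2:ℝ) := by gcongr
    linarith

lemma interp_int {n : ℕ} (u : E n → ℝ) (hu : Continuous u) (p r l : ℝ) (hp : 2 < p) (hpr : p < r)
    (hl : 0 < l) : ∫ x, |u x| ^ p ∂(sphMeasure n) ≤
      l ^ (p-r) * ∫ x, |u x| ^ r ∂(sphMeasure n) + l ^ (p-2) * ∫ x, (u x) ^ 2 ∂(sphMeasure n) := by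
  have hi : ∀ s : ℝ, 0 ≤ s → Integrable (fun x => |u x| ^ s) (sphMeasure n) := fun s hs =>
    int_sph _ (hu.abs.rpow_const (fun _ => Or.inr hs))
  have e : ∫ x, |u x| ^ (2:ℝ) ∂(sphMeasure n) = ∫ x, (u x) ^ 2 ∂(sphMeasure n) := by
    congr 1; ext x; simp
  rw [← e, ← integral_const_mul, ← integral_const_mul,
    ← integral_add ((hi r (by linarith)).const_mul _) ((hi 2 (by norm_num)).const_mul _)]
  apply integral_mono (hi p (by linarith))
    (((hi r (by linarith)).const_mul _).add ((hi 2 (by norm_num)).const_mul _))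
  intro x
  exact interp_pt p r l |u x| hp hpr hl (abs_nonneg _)

/-- The real-variable interpolation step. -/
lemma final_step (p r c ε : ℝ) (hp : 2 < p) (hpr : p < r) (hc : 0 ≤ c) (hε : 0 < ε) :
    ∃ C > (0:ℝ), ∀ A G S : ℝ, 0 ≤ A → 0 ≤ G → 0 < S →
      (∀ l > (0:ℝ), A ≤ l ^ (p-r) * (c * (G+S) ^ (r/2)) + l ^ (p-2) * S) →
      A ^ (2/p) ≤ ε * G + C * S := by
  -- choose `L` with `L^(p-r) * c` small, then `η`
  have hp0 : 0 < p := by linarith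
  set δ := (ε) ^ (p/2) with hδ
  have hδ0 : 0 < δ := by positivity
  obtain ⟨L, hL0, hL⟩ : ∃ L > (0:ℝ), L ^ (p-r) * c ≤ δ/2 := by
    refine ⟨(δ/2/(c+1)) ^ ((p-r)⁻¹), by positivity, ?_⟩
    rw [Real.rpow_inv_rpow (by positivity) (by linarith)]
    rw [div_mul_eq_mul_div, div_le_iff₀ (by linarith)]
    nlinarith
  set η := δ/2 / L ^ (p-2) with hη
  have hη0 : 0 < η := by positivity
  set M := (L ^ (p-r) * c + L ^ (p-2)) ^ (2/p) with hM
  have hM0 : 0 ≤ M := by positivity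
  refine ⟨ε + M * (1/η + 1) , by positivity, fun A G S hA hG hS h => ?_⟩
  set K := G + S with hK
  have hK0 : 0 < K := by linarith
  have e1 : (L * K ^ (1/2:ℝ)) ^ (p-r) * (c * K ^ (r/2)) = L ^ (p-r) * c * K ^ (p/2) := by
    rw [Real.mul_rpow hL0.le (by positivity), ← Real.rpow_mul hK0.le]
    have : K ^ (p/2) = K ^ (1/2 * (p-r)) * K ^ (r/2) := by
      rw [← Real.rpow_add hK0]; congr 1; ring
    rw [this]; ring
  have e2 : (L * K ^ (1/2:ℝ)) ^ (p-2) * K = L ^ (p-2) * K ^ (p/2) := by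
    rw [Real.mul_rpow hL0.le (by positivity), ← Real.rpow_mul hK0.le]
    have : K ^ (p/2) = K ^ (1/2 * (p-2)) * K := by
      nth_rewrite 3 [← Real.rpow_one K]
      rw [← Real.rpow_add hK0]; congr 1; ring
    rw [this]; ring
  have hl := h (L * K ^ (1/2:ℝ)) (by positivity)
  rw [e1] at hl
  have e3 : ∀ B : ℝ, 0 ≤ B → A ≤ B * K ^ (p/2) → A ^ (2/p) ≤ B ^ (2/p) * K := by
    intro B hB hAB
    refine (Real.rpow_le_rpow hA hAB (by positivity)).trans (le_of_eq ?_)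
    rw [Real.mul_rpow hB (by positivity), ← Real.rpow_mul hK0.le,
      show p/2 * (2/p) = 1 by field_simp, Real.rpow_one]
  have hP : 0 ≤ (L * K ^ (1/2:ℝ)) ^ (p-2) := by positivity
  by_cases hcase : S ≤ η * K
  · have h1 : A ≤ δ * K ^ (p/2) := by
      have h2 : (L * K ^ (1/2:ℝ)) ^ (p-2) * S ≤ δ/2 * K ^ (p/2) := by
        calc _ ≤ (L * K ^ (1/2:ℝ)) ^ (p-2) * (η * K) := by gcongr
          _ = η * ((L * K ^ (1/2:ℝ)) ^ (p-2) * K) := by ring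
          _ = _ := by rw [e2, hη]; field_simp
      have h3 : L ^ (p-r) * c * K ^ (p/2) ≤ δ/2 * K ^ (p/2) := by gcongr
      linarith
    have h4 := e3 δ hδ0.le h1
    rw [hδ, ← Real.rpow_mul hε.le, show p/2 * (2/p) = 1 by field_simp, Real.rpow_one] at h4
    have : 0 ≤ M * (1/η+1) * S := by positivity
    rw [hK] at h4
    linarith
  · push Not at hcase
    have h1 : A ≤ (L ^ (p-r) * c + L ^ (p-2)) * K ^ (p/2) := by
      have h2 : (L * K ^ (1/2:ℝ)) ^ (p-2) * S ≤ L ^ (p-2) * K ^ (p/2) := by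
        rw [← e2]; gcongr; linarith
      linarith
    have h4 := e3 _ (by positivity) h1
    rw [← hM] at h4
    have h5 : K ≤ 1/η * S := by
      rw [one_div, inv_mul_eq_div, le_div_iff₀ hη0]; linarith
    have h6 : M * K ≤ M * (1/η * S) := by gcongr
    have h7 : 0 ≤ ε * G := by positivity
    have h8 : 0 ≤ ε * S := by positivity
    have h9 : 0 ≤ M * S := by positivity
    linarith

theorem stmt0 (n : ℕ) (hn : 3 ≤ n) (m : ℕ) (q : ℝ) (hq1 : 1 < q)
    (hq2 : q < (n : ℝ) / ((n : ℝ) - 2)) :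
    ∀ ε > (0:ℝ), ∃ C > (0:ℝ), ∀ u : E n → ℝ, ContDiff ℝ (⊤ : ℕ∞) u →
      (∀ p ∈ P0 n m,
        ∫ x, MvPolynomial.eval (fun i => x i) p * |u x| ^ (q + 1) ∂(sphMeasure n) = 0) →
      (∫ x, |u x| ^ (q + 1) ∂(sphMeasure n)) ^ (2 / (q + 1)) ≤
        ε * (∫ x in Metric.ball (0 : E n) 1, ‖fderiv ℝ u x‖ ^ 2) +
          C * ∫ x, (u x) ^ 2 ∂(sphMeasure n) := by
  intro ε hε
  have hn3 : (3:ℝ) ≤ n := by exact_mod_cast hn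
  have hn2 : (0:ℝ) < n - 2 := by linarith
  have hlt : q + 1 < 2 * (n - 1) / ((n:ℝ) - 2) := by
    rw [lt_div_iff₀ hn2] at hq2 ⊢
    nlinarith
  obtain ⟨r, hr1, hr2⟩ := exists_between hlt
  rw [lt_div_iff₀ hn2] at hr2
  obtain ⟨c, hc, htr⟩ := trace_real n hn r (by linarith) hr2
  obtain ⟨C, hC, hfin⟩ := final_step (q+1) r c ε (by linarith) hr1 hc hε
  refine ⟨C, hC, fun u hu _ => ?_⟩
  have hG : 0 ≤ ∫ x in Metric.ball (0 : E n) 1, ‖fderiv ℝ u x‖ ^ 2 :=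
    integral_nonneg fun x => by positivity
  have hS : 0 ≤ ∫ x, (u x) ^ 2 ∂(sphMeasure n) := integral_nonneg fun x => by positivity
  have hA : 0 ≤ ∫ x, |u x| ^ (q+1) ∂(sphMeasure n) := integral_nonneg fun x => by positivity
  rcases eq_or_lt_of_le hS with h0 | hS0
  · have hz := (integral_eq_zero_iff_of_nonneg (fun x => sq_nonneg (u x))
      (int_sph _ (hu.continuous.pow 2))).1 h0.symm
    have : ∫ x, |u x| ^ (q+1) ∂(sphMeasure n) = 0 := by
      apply integral_eq_zero_of_ae
      filter_upwards [hz] with x hx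
      have : u x = 0 := by simpa using hx
      simp only [this, abs_zero, Pi.zero_apply]
      exact Real.zero_rpow (by linarith)
    rw [this, ← h0, Real.zero_rpow (div_pos two_pos (by linarith)).ne']
    positivity
  · refine hfin _ _ _ hA hG hS0 fun l hl => ?_
    refine (interp_int u hu.continuous (q+1) r l (by linarith) hr1 hl).trans ?_
    gcongr
    exact htr u hu
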